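/- If a string w has a run-length SLP of size g, then its LZ77 parse with overlaps has at most g phrases (z ≤ g*_{rl}). -/

import Mathlib

/-- A right-hand side of a run-length SLP rule: either a concatenation of
nonterminals and terminals, or a power `Y^ℓ`. -/
inductive RLRhs (n : ℕ) (α : Type*) where
  | cat : List (Fin n ⊕ α) → RLRhs n α
  | pow : Fin n → ℕ → RLRhs n α

/-- A run-length SLP: an SLP extended with run-length rules `X → Y^ℓ`, `ℓ ≥ 2`.
Rules may only reference nonterminals of smaller index; the start symbol is
the last nonterminal. -/
structure RLSLP (α : Type*) where
  n : ℕ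
  rhs : Fin n → RLRhs n α
  dec : ∀ i j, (∃ l, rhs i = .cat l ∧ Sum.inl j ∈ l) ∨ (∃ ℓ, rhs i = .pow j ℓ) → j < i
  pow_ge : ∀ i j ℓ, rhs i = .pow j ℓ → 2 ≤ ℓ

namespace RLSLP

variable {α : Type*}

/-- The string derived from nonterminal `i`. -/
def expand (G : RLSLP α) (i : Fin G.n) : List α :=
  match h : G.rhs i with
  | .cat l => (l.attach.map (fun x =>
      match x with
      | ⟨Sum.inl j, _⟩ => G.expand j
      | ⟨Sum.inr a, _⟩ => [a])).flatten
  | .pow j ℓ => (List.replicate ℓ (G.expand j)).flatten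
termination_by i.1
decreasing_by
  · exact G.dec i _ (Or.inl ⟨l, h, by assumption⟩)
  · exact G.dec i j (Or.inr ⟨ℓ, h⟩)

/-- The size of a rule: the length of a concatenation right-hand side;
a run-length rule `X → Y^ℓ` counts as size `2`. -/
def rhsSize {n : ℕ} : RLRhs n α → ℕ
  | .cat l => l.length
  | .pow _ _ => 2

/-- The size of a run-length SLP: the total size of all rules. -/
def size (G : RLSLP α) : ℕ := ∑ i, rhsSize (G.rhs i)

/-- `G` generates exactly the string `w` (derived from the start symbol). -/
def Generates (G : RLSLP α) (w : List α) : Prop :=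
  ∃ h : 0 < G.n, G.expand ⟨G.n - 1, Nat.sub_lt h one_pos⟩ = w

/-- The size of the smallest run-length SLP generating `w`. -/
noncomputable def gStarRL (w : List α) : ℕ :=
  sInf {g | ∃ G : RLSLP α, G.Generates w ∧ G.size = g}

end RLSLP

variable {α : Type*} [DecidableEq α]

/-- The length of the next greedy LZ77 phrase without overlaps: the largest
`L` such that the length-`L` prefix of the remainder `t` occurs as a substring
of the already-parsed prefix `p` (`0` if there is none). -/
def lzNoLen (p t : List α) : ℕ :=
  Nat.findGreatest (fun L => 0 < L ∧ (t.take L) <:+: p) t.length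

/-- Greedy LZ77 without overlaps: `p` is the already parsed prefix, `r` the
remainder. Each phrase is the longest nonempty prefix of `r` occurring
entirely earlier, or else a single fresh symbol. -/
def lzNoAux (p r : List α) : List (List α) :=
  match r with
  | [] => []
  | a :: r' =>
    if hL : lzNoLen p (a :: r') = 0 then [a] :: lzNoAux (p ++ [a]) r'
    else ((a :: r').take (lzNoLen p (a :: r'))) ::
      lzNoAux (p ++ (a :: r').take (lzNoLen p (a :: r'))) ((a :: r').drop (lzNoLen p (a :: r')))
termination_by r.length
decreasing_by
  · simp
  · have := Nat.pos_of_ne_zero hL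
    simp only [List.length_drop, List.length_cons]
    omega

/-- The greedy LZ77 parse without overlaps. -/
def lzNo (s : List α) : List (List α) := lzNoAux [] s

/-- The length of the next greedy LZ77 phrase with overlaps: the largest `L`
such that the length-`L` prefix of the remainder `t` can be copied from a
source occurrence starting strictly before position `|p|` (possibly
overlapping the phrase itself). -/
def lzOvLen (p t : List α) : ℕ :=
  Nat.findGreatest
    (fun L => 0 < L ∧ ∃ j < p.length, ((p ++ t.take L).drop j).take L = t.take L)
    t.length

/-- Greedy LZ77 with overlaps between phrases and their sources. -/
def lzOvAux (p r : List α) : List (List α) :=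
  match r with
  | [] => []
  | a :: r' =>
    if hL : lzOvLen p (a :: r') = 0 then [a] :: lzOvAux (p ++ [a]) r'
    else ((a :: r').take (lzOvLen p (a :: r'))) ::
      lzOvAux (p ++ (a :: r').take (lzOvLen p (a :: r'))) ((a :: r').drop (lzOvLen p (a :: r')))
termination_by r.length
decreasing_by
  · simp
  · have := Nat.pos_of_ne_zero hL
    simp only [List.length_drop, List.length_cons]
    omega

/-- The greedy LZ77 parse with overlaps. -/
def lzOv (s : List α) : List (List α) := lzOvAux [] s


def LZPhrase {α : Type*} (p x : List α) : Prop :=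
  ∃ u v e : List α, p = u ++ v ∧ v ≠ [] ∧ v ++ x = x ++ e

theorem LZPhrase.split {α : Type*} {v x₁ x₂ e : List α}
    (h : v ++ (x₁ ++ x₂) = (x₁ ++ x₂) ++ e) :
    ∃ v', v ++ x₁ = x₁ ++ v' ∧ v' ++ x₂ = x₂ ++ e ∧ v'.length = v.length := by
  have h1 : (v ++ x₁) ++ x₂ = x₁ ++ (x₂ ++ e) := by simpa using h
  have hp : x₁ <+: v ++ x₁ := by
    apply List.prefix_of_prefix_length_le (l₃ := (v ++ x₁) ++ x₂)
    · rw [h1]; exact List.prefix_append _ _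
    · exact List.prefix_append _ _
    · simp
  obtain ⟨v', hv⟩ := hp
  refine ⟨v', hv.symm, ?_, ?_⟩
  · rw [← hv] at h1
    simpa using h1
  · have := congrArg List.length hv
    simp at this; omega

theorem LZPhrase.pre {α : Type*} {p x₁ x₂ : List α} (h : LZPhrase p (x₁ ++ x₂)) :
    LZPhrase p x₁ := by
  obtain ⟨u, v, e, hp, hv, he⟩ := h
  obtain ⟨v', h1, -, -⟩ := LZPhrase.split he
  exact ⟨u, v, v', hp, hv, h1⟩

theorem LZPhrase.suf {α : Type*} {p x₁ x₂ : List α} (h : LZPhrase p (x₁ ++ x₂)) :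
    LZPhrase (p ++ x₁) x₂ := by
  obtain ⟨u, v, e, hp, hv, he⟩ := h
  obtain ⟨v', h1, h2, h3⟩ := LZPhrase.split he
  refine ⟨u ++ x₁, v', e, ?_, ?_, h2⟩
  · simp [hp, h1]
  · rintro rfl
    exact hv (List.length_eq_zero_iff.1 h3.symm)

theorem LZPhrase.of_infix {α : Type*} {p x : List α} (hx : x ≠ []) (h : x <:+: p) :
    LZPhrase p x := by
  obtain ⟨u, e, rfl⟩ := h
  exact ⟨u, x ++ e, e ++ x, by simp, by simp [hx], by simp⟩

theorem lz_cond_iff {α : Type*} (p t : List α) (L : ℕ) (hL : L ≤ t.length) :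
    (∃ j < p.length, ((p ++ t.take L).drop j).take L = t.take L) ↔ LZPhrase p (t.take L) := by
  have hlen : (t.take L).length = L := by simp [hL]
  generalize t.take L = x at hlen
  subst hlen
  constructor
  · rintro ⟨j, hj, h⟩
    refine ⟨p.take j, p.drop j, ((p ++ x).drop j).drop x.length, by simp, by simpa using hj, ?_⟩
    have h2 := List.take_append_drop x.length ((p ++ x).drop j)
    rw [h] at h2
    rw [h2, List.drop_append_of_le_length hj.le]
  · rintro ⟨u, v, e, rfl, hv, he⟩
    refine ⟨u.length, ?_, ?_⟩
    · have := List.length_pos_iff.2 hv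
      simpa using this
    · simp [he]

theorem lzOvLen_le {α : Type*} [DecidableEq α] (p t : List α) : lzOvLen p t ≤ t.length :=
  Nat.findGreatest_le _

theorem lzOvLen_phrase {α : Type*} [DecidableEq α] (p t : List α) (h : lzOvLen p t ≠ 0) :
    LZPhrase p (t.take (lzOvLen p t)) := by
  have := Nat.findGreatest_of_ne_zero (m := lzOvLen p t) (rfl) h
  exact (lz_cond_iff p t _ (lzOvLen_le p t)).1 this.2

theorem le_lzOvLen {α : Type*} [DecidableEq α] (p x y : List α) (h : LZPhrase p x) :
    x.length ≤ lzOvLen p (x ++ y) := by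
  rcases Nat.eq_zero_or_pos x.length with h0 | h0
  · omega
  · apply Nat.le_findGreatest
    · simp
    · exact ⟨h0, (lz_cond_iff p (x ++ y) _ (by simp)).2 (by simpa using h)⟩

/-- greedy step: next phrase `x` -/
theorem lz_step {α : Type*} [DecidableEq α] (p r : List α) (hr : r ≠ []) :
    ∃ x y, r = x ++ y ∧ x ≠ [] ∧ (x.length = 1 ∨ LZPhrase p x) ∧
      (lzOvAux p r).length = 1 + (lzOvAux (p ++ x) y).length ∧
      (∀ x' y', r = x' ++ y' → LZPhrase p x' → x'.length ≤ x.length) := by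
  obtain ⟨a, r', rfl⟩ := List.exists_cons_of_ne_nil hr
  by_cases hL : lzOvLen p (a :: r') = 0
  · refine ⟨[a], r', rfl, by simp, by simp, ?_, ?_⟩
    · rw [lzOvAux]; simp [hL]; omega
    · intro x' y' h h'
      have := le_lzOvLen p x' y' h'
      rw [← h] at this; omega
  · refine ⟨(a :: r').take (lzOvLen p (a :: r')), (a :: r').drop (lzOvLen p (a :: r')),
      (List.take_append_drop _ _).symm, by simp [hL], Or.inr (lzOvLen_phrase _ _ hL), ?_, ?_⟩
    · rw [lzOvAux]; rw [dif_neg hL, List.length_cons]; omega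
    · intro x' y' h h'
      have := le_lzOvLen p x' y' h'
      rw [← h] at this
      rw [List.length_take]
      have := lzOvLen_le p (a :: r')
      omega

theorem lz_mono {α : Type*} [DecidableEq α] (N : ℕ) : ∀ (p x y : List α), (x ++ y).length ≤ N →
    (lzOvAux (p ++ x) y).length ≤ (lzOvAux p (x ++ y)).length := by
  induction N with
  | zero =>
    intro p x y h
    have : x = [] := List.length_eq_zero_iff.1 (by simp at h; simp [h])
    subst this; simp
  | succ N ih =>
    intro p x y h
    by_cases hx : x = []
    · subst hx; simp
    by_cases hy : y = []
    · subst hy; simp [lzOvAux]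
    obtain ⟨q, z, hqz, hq, hph, hlen, -⟩ := lz_step p (x ++ y) (by simp [hx])
    rw [hlen]
    have hq0 := List.length_pos_iff.2 hq
    have hl := congrArg List.length hqz
    simp only [List.length_append] at hl h
    rcases List.append_eq_append_iff.1 hqz with ⟨b, hb, hc⟩ | ⟨b, hb, hc⟩
    · -- q = x ++ b, y = b ++ z
      by_cases hb0 : b = []
      · subst hb0; simp at hb hc; subst hb hc; omega
      have hphb : LZPhrase (p ++ x) b := by
        rcases hph with h1 | h1
        · rw [hb, List.length_append] at h1
          have := List.length_pos_iff.2 hx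
          have := List.length_pos_iff.2 hb0
          omega
        · rw [hb] at h1; exact h1.suf
      obtain ⟨q', z', hqz', hq', -, hlen', hmax⟩ := lz_step (p ++ x) y hy
      have hle := hmax b z hc hphb
      rw [hlen']
      have hpre : b <+: q' := by
        apply List.prefix_of_prefix_length_le (l₃ := y) _ _ hle
        · rw [hc]; exact List.prefix_append _ _
        · rw [hqz']; exact List.prefix_append _ _
      obtain ⟨c, rfl⟩ := hpre
      have hz : z = c ++ z' := by
        rw [hc] at hqz'; simpa using hqz'
      have := ih (p ++ q) c z' (by rw [← hz]; omega)
      rw [← hz] at this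
      rw [hb] at this ⊢
      simp only [List.append_assoc] at this ⊢
      omega
    · -- x = q ++ b, z = b ++ y
      have := ih (p ++ q) b y (by rw [← hc]; omega)
      rw [hb, hc]
      simp only [List.append_assoc] at this ⊢
      omega

theorem lz_one {α : Type*} [DecidableEq α] (p x y : List α)
    (h : x.length ≤ 1 ∨ LZPhrase p x) :
    (lzOvAux p (x ++ y)).length ≤ 1 + (lzOvAux (p ++ x) y).length := by
  by_cases hx : x = []
  · subst hx; simp
  obtain ⟨q, z, hqz, hq, -, hlen, hmax⟩ := lz_step p (x ++ y) (by simp [hx])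
  have hle : x.length ≤ q.length := by
    rcases h with h | h
    · have := List.length_pos_iff.2 hq
      omega
    · exact hmax x y rfl h
  have hpre : x <+: q := by
    apply List.prefix_of_prefix_length_le (l₃ := x ++ y) _ _ hle
    · exact List.prefix_append _ _
    · rw [hqz]; exact List.prefix_append _ _
  obtain ⟨c, rfl⟩ := hpre
  have hz : y = c ++ z := by simpa using hqz
  rw [hlen]
  have := lz_mono _ (p ++ x) c z le_rfl
  rw [← hz] at this
  simp only [List.append_assoc] at this ⊢
  omega

namespace RLSLP

def symExp {α : Type*} (G : RLSLP α) : Fin G.n ⊕ α → List α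
  | Sum.inl j => G.expand j
  | Sum.inr a => [a]

theorem expand_cat {α : Type*} (G : RLSLP α) (i : Fin G.n) (l) (h : G.rhs i = .cat l) :
    G.expand i = (l.map G.symExp).flatten := by
  rw [expand]
  split
  · rename_i l' h'
    rw [h] at h'
    cases h'
    congr 1
    conv_rhs => rw [← List.attach_map_subtype_val l, List.map_map]
    apply List.map_congr_left
    rintro ⟨x | x, hx⟩ - <;> simp [symExp]
  · rename_i h'
    rw [h] at h'; cases h'

theorem expand_pow {α : Type*} (G : RLSLP α) (i j : Fin G.n) (k) (h : G.rhs i = .pow j k) :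
    G.expand i = (List.replicate k (G.expand j)).flatten := by
  rw [expand]
  split
  · rename_i h'
    rw [h] at h'; cases h'
  · rename_i h'
    rw [h] at h'; cases h'; rfl

def Seen {α : Type*} (G : RLSLP α) (S : Finset (Fin G.n)) (p : List α) : Prop :=
  ∀ j ∈ S, G.expand j <:+: p

/-- processing the string `x` at the cost of `c` plus the rules newly visited, all `< b`. -/
def Proc {α : Type*} [DecidableEq α] (G : RLSLP α) (b : ℕ) (S : Finset (Fin G.n))
    (p x r : List α) (c : ℕ) (S' : Finset (Fin G.n)) : Prop :=
  S ⊆ S' ∧ G.Seen S' (p ++ x) ∧ (∀ j ∈ S', j ∈ S ∨ j.1 < b) ∧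
    (lzOvAux p (x ++ r)).length + ∑ j ∈ S, rhsSize (G.rhs j) ≤
      (lzOvAux (p ++ x) r).length + ∑ j ∈ S', rhsSize (G.rhs j) + c

theorem Seen.append {α : Type*} {G : RLSLP α} {S p} (h : G.Seen S p) (x : List α) :
    G.Seen S (p ++ x) := fun j hj => (h j hj).trans (List.infix_append' [] p x)

theorem proc_one {α : Type*} [DecidableEq α] (G : RLSLP α) (b : ℕ) (S : Finset (Fin G.n))
    (p x r : List α) (hS : G.Seen S p) (h : x.length ≤ 1 ∨ LZPhrase p x) :
    G.Proc b S p x r 1 S := by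
  refine ⟨subset_rfl, hS.append x, fun j hj => Or.inl hj, ?_⟩
  have := lz_one p x r h
  omega

theorem Proc.comp {α : Type*} [DecidableEq α] {G : RLSLP α} {b : ℕ} {S S' S'' : Finset (Fin G.n)}
    {p x y r : List α} {c d : ℕ} (h : G.Proc b S p x (y ++ r) c S')
    (h' : G.Proc b S' (p ++ x) y r d S'') : G.Proc b S p (x ++ y) r (c + d) S'' := by
  obtain ⟨h1, h2, h3, h4⟩ := h
  obtain ⟨k1, k2, k3, k4⟩ := h'
  refine ⟨h1.trans k1, by simpa using k2, ?_, ?_⟩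
  · intro j hj
    rcases k3 j hj with h | h
    · exact h3 j h
    · exact Or.inr h
  · simp only [List.append_assoc] at *
    omega

theorem Proc.mono {α : Type*} [DecidableEq α] {G : RLSLP α} {b b' : ℕ} {S S' : Finset (Fin G.n)}
    {p x r : List α} {c d : ℕ} (h : G.Proc b S p x r c S') (hb : b ≤ b') (hc : c ≤ d) :
    G.Proc b' S p x r d S' := by
  obtain ⟨h1, h2, h3, h4⟩ := h
  refine ⟨h1, h2, fun j hj => (h3 j hj).imp id (fun h => by omega), by omega⟩

theorem proc_list {α : Type*} [DecidableEq α] (G : RLSLP α) (b : ℕ) (l : List (Fin G.n ⊕ α))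
    (hsym : ∀ s ∈ l, ∀ S p r, G.Seen S p → ∃ S', G.Proc b S p (G.symExp s) r 1 S') :
    ∀ S p r, G.Seen S p → ∃ S', G.Proc b S p (l.map G.symExp).flatten r l.length S' := by
  induction l with
  | nil =>
    intro S p r hS
    exact ⟨S, subset_rfl, by simpa using hS, fun j hj => Or.inl hj, by simp⟩
  | cons s l ih =>
    intro S p r hS
    obtain ⟨S', h⟩ := hsym s (by simp) S p ((l.map G.symExp).flatten ++ r) hS
    obtain ⟨S'', h'⟩ := ih (fun t ht => hsym t (by simp [ht])) S' (p ++ G.symExp s) r h.2.1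
    refine ⟨S'', ?_⟩
    have := (h.comp h').mono le_rfl (d := (s :: l).length) (by simp; omega)
    simpa using this

theorem proc_main {α : Type*} [DecidableEq α] (G : RLSLP α) (N : ℕ) : ∀ i : Fin G.n, i.1 < N →
    ∀ S p r, G.Seen S p → i ∉ S → ∃ S', G.Proc (i.1 + 1) S p (G.expand i) r 0 S' := by
  induction N with
  | zero => intro i hi; omega
  | succ N ih =>
    intro i hi S p r hS hiS
    have hsym : ∀ s : Fin G.n ⊕ α, (∀ j, s = Sum.inl j → j < i) → ∀ S p r, G.Seen S p →
        ∃ S', G.Proc i.1 S p (G.symExp s) r 1 S' := by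
      intro s hs S p r hS
      rcases s with j | a
      · have hj : j.1 < i.1 := hs j rfl
        by_cases hjS : j ∈ S
        · refine ⟨S, proc_one G _ S p _ r hS ?_⟩
          by_cases he : G.expand j = []
          · left; simp [symExp, he]
          · right; exact LZPhrase.of_infix he (hS j hjS)
        · obtain ⟨S', h⟩ := ih j (by omega) S p r hS hjS
          exact ⟨S', h.mono (by omega) (by omega)⟩
      · exact ⟨S, proc_one G _ S p _ r hS (by left; simp [symExp])⟩
    have key : ∃ S', G.Proc i.1 S p (G.expand i) r (rhsSize (G.rhs i)) S' := by
      cases hr : G.rhs i with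
      | cat l =>
        rw [expand_cat G i l hr]
        refine proc_list G i.1 l (fun s hs => hsym s ?_) S p r hS
        rintro j rfl
        exact G.dec i j (Or.inl ⟨l, hr, hs⟩)
      | pow j k =>
        rw [expand_pow G i j k hr]
        have hk := G.pow_ge i j k hr
        obtain ⟨m, rfl⟩ : ∃ m, k = m + 1 := ⟨k - 1, by omega⟩
        obtain ⟨S', h⟩ := hsym (Sum.inl j)
          (fun j' hj' => by cases hj'; exact G.dec i j (Or.inr ⟨_, hr⟩)) S p
          ((List.replicate m (G.expand j)).flatten ++ r) hS
        refine ⟨S', ?_⟩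
        have h2 := proc_one G i.1 S' (p ++ G.expand j) (List.replicate m (G.expand j)).flatten r
          h.2.1 ?_
        · have := h.comp h2
          simpa [List.replicate_succ, rhsSize, symExp] using this
        · by_cases he : G.expand j = []
          · left; simp [he]
          · right
            refine ⟨p, G.expand j, G.expand j, rfl, he, ?_⟩
            rw [← List.flatten_cons, ← List.replicate_succ, List.replicate_succ']
            simp
    obtain ⟨S', h1, h2, h3, h4⟩ := key
    have hi' : i ∉ S' := fun h => by
      rcases h3 i h with h | h
      · exact hiS h
      · omega
    refine ⟨insert i S', h1.trans (Finset.subset_insert _ _), ?_, ?_, ?_⟩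
    · intro j hj
      rcases Finset.mem_insert.1 hj with rfl | hj
      · exact (List.suffix_append _ _).isInfix
      · exact h2 j hj
    · intro j hj
      rcases Finset.mem_insert.1 hj with rfl | hj
      · right; omega
      · exact (h3 j hj).imp id (fun h => by omega)
    · rw [Finset.sum_insert hi']; omega

end RLSLP

/-- the number of phrases of the greedy LZ77 parse with overlaps
of `w` is at most the size of any run-length SLP generating `w`. -/
theorem lzOv_le_rlslp_size {α : Type*} [DecidableEq α] (w : List α)
    (G : RLSLP α) (hG : G.Generates w) :
    (lzOv w).length ≤ G.size := by
  obtain ⟨h, rfl⟩ := hG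
  obtain ⟨S', -, -, -, h4⟩ := RLSLP.proc_main G G.n ⟨G.n - 1, Nat.sub_lt h one_pos⟩
    (Nat.sub_lt h one_pos) ∅ [] [] (fun j hj => by simp at hj) (by simp)
  have h5 : ∑ j ∈ S', RLSLP.rhsSize (G.rhs j) ≤ G.size :=
    Finset.sum_le_sum_of_subset (Finset.subset_univ _)
  have h6 : ∀ q : List α, (lzOvAux q []).length = 0 := fun q => by simp [lzOvAux]
  simp only [List.append_nil, h6, Finset.sum_empty] at h4
  unfold lzOv
  omega
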